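/- Fix a positive integer M. Let S be the subsemigroup of SL₂(ℤ) generated by a set of matrices, each of which is of the form [[a, -b], [c, -d]] with integers satisfying 0 < d, d < M·b, and M·b < a. Then every element of S (i.e., every finite nonempty product of generators) is again of the form [[a, -b], [c, -d]] with 0 < d < M·b < a. In particular, the identity matrix does not belong to S. -/

import Mathlib

/-- The inequalities `0 < d < M·b < a` are preserved by multiplication of matrices
`[[a, -b], [c, -d]]` of determinant one. -/
theorem form_mul_bounds {M a b c d a' b' c' d' : ℤ} (hM : 0 < M)
    (hdet : b * c = 1 + a * d) (hd : 0 < d) (hdb : d < M * b) (hba : M * b < a)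
    (hdet' : b' * c' = 1 + a' * d') (hd' : 0 < d') (hdb' : d' < M * b') (hba' : M * b' < a') :
    0 < c * b' - d * d' ∧ c * b' - d * d' < M * (a * b' - b * d') ∧
      M * (a * b' - b * d') < a * a' - b * c' := by
  have hb : 0 < b := pos_of_mul_pos_right (hd.trans hdb) hM.le
  have hb' : 0 < b' := pos_of_mul_pos_right (hd'.trans hdb') hM.le
  have hB : b + b' ≤ a * b' - b * d' := by
    nlinarith [mul_le_mul_of_nonneg_right (Int.add_one_le_of_lt hba) hb'.le,
      mul_le_mul_of_nonneg_left (Int.add_one_le_of_lt hdb') hb.le]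
  have hD : b * (c * b' - d * d') = b' + d * (a * b' - b * d') := by
    linear_combination b' * hdet
  have hA : b' * (a * a' - b * c') = a' * (a * b' - b * d') - b := by
    linear_combination -b * hdet'
  generalize a * b' - b * d' = B at *
  have hBpos : 0 < B := by linarith
  refine ⟨pos_of_mul_pos_right (a := b) (hD ▸ by positivity) hb.le,
    lt_of_mul_lt_mul_left (a := b) ?_ hb.le, lt_of_mul_lt_mul_left (a := b') ?_ hb'.le⟩
  · nlinarith [mul_le_mul_of_nonneg_right (Int.add_one_le_of_lt hdb) hBpos.le]
  · nlinarith [mul_le_mul_of_nonneg_right (Int.add_one_le_of_lt hba') hBpos.le]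


/-- Fix a positive integer `M`. If every generator of a subsemigroup `S` of `SL₂(ℤ)`
is of the form `[[a, -b], [c, -d]]` with `0 < d < M·b < a`, then every element of `S`
is again of this form; in particular the identity matrix does not belong to `S`. -/
theorem subsemigroup_of_sl2z_form (M : ℤ) (hM : 0 < M) (S : Set (Matrix (Fin 2) (Fin 2) ℤ))
    (hS : ∀ A ∈ S, A.det = 1 ∧ ∃ a b c d : ℤ,
      A = !![a, -b; c, -d] ∧ 0 < d ∧ d < M * b ∧ M * b < a) :
    (∀ A ∈ Subsemigroup.closure S, A.det = 1 ∧ ∃ a b c d : ℤ,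
      A = !![a, -b; c, -d] ∧ 0 < d ∧ d < M * b ∧ M * b < a) ∧
    (1 : Matrix (Fin 2) (Fin 2) ℤ) ∉ Subsemigroup.closure S := by
  have key : ∀ A ∈ Subsemigroup.closure S, A.det = 1 ∧ ∃ a b c d : ℤ,
      A = !![a, -b; c, -d] ∧ 0 < d ∧ d < M * b ∧ M * b < a := by
    intro A hA
    induction hA using Subsemigroup.closure_induction with
    | mem A hA => exact hS A hA
    | mul A A' _ _ ih ih' =>
      obtain ⟨hdet, a, b, c, d, rfl, hd, hdb, hba⟩ := ih
      obtain ⟨hdet', a', b', c', d', rfl, hd', hdb', hba'⟩ := ih'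
      refine ⟨by rw [Matrix.det_mul, hdet, hdet', one_mul], a * a' - b * c', a * b' - b * d',
        c * a' - d * c', c * b' - d * d', ?_, ?_⟩
      · rw [Matrix.mul_fin_two]
        ring_nf
      · rw [Matrix.det_fin_two_of] at hdet hdet'
        exact form_mul_bounds hM (by linarith) hd hdb hba (by linarith) hd' hdb' hba'
  refine ⟨key, fun h => ?_⟩
  obtain ⟨-, a, b, c, d, h, hd, hdb, -⟩ := key 1 h
  have hb : b = 0 := by simpa using congrFun (congrFun h 0) 1
  rw [hb, mul_zero] at hdb
  exact hd.not_gt hdb
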